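/- arXiv:2101.12564 — 2 statements merged into one kernel-verified Lean document; each statement's English description precedes it below -/
import Mathlib

section
/- For every β ≥ 0 and finite alphabets, the maximum of β I(Y;W) − H(W) over all conditional distributions P_{W|X} (with Y–X–W a Markov chain and |𝒲| finite) is attained by a deterministic conditional distribution, i.e., one where P_{W|X}(w|x) ∈ {0,1} for all x ∈ 𝒳 and w ∈ 𝒲. -/
open Real BigOperators Filter

noncomputable section

/-- Base-2 Shannon entropy of a probability vector on a finite alphabet. -/
def shEnt {I : Type} [Fintype I] (P : I → ℝ) : ℝ := -∑ i, P i * Real.logb 2 (P i)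

/-- Rényi entropy of order `α` (base 2) of a probability vector. -/
def renyiEnt {I : Type} [Fintype I] (α : ℝ) (P : I → ℝ) : ℝ :=
  (1 - α)⁻¹ * Real.logb 2 (∑ i, P i ^ α)

open Classical in
/-- Entropy of order `α`, where `α = 1` is understood as Shannon entropy. -/
def entOrd {I : Type} [Fintype I] (α : ℝ) (P : I → ℝ) : ℝ :=
  if α = 1 then shEnt P else renyiEnt α P

/-- `p` is a joint pmf on `Y × X`. -/
def IsJointPmf {Y X : Type} [Fintype Y] [Fintype X] (p : Y → X → ℝ) : Prop :=
  (∀ y x, 0 ≤ p y x) ∧ ∑ y, ∑ x, p y x = 1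

/-- `q` is a channel (conditional pmf) from `X` to `W`. -/
def IsKernel {X W : Type} [Fintype X] [Fintype W] (q : X → W → ℝ) : Prop :=
  (∀ x w, 0 ≤ q x w) ∧ ∀ x, ∑ w, q x w = 1

def margX {Y X : Type} [Fintype Y] [Fintype X] (p : Y → X → ℝ) (x : X) : ℝ := ∑ y, p y x

def margY {Y X : Type} [Fintype Y] [Fintype X] (p : Y → X → ℝ) (y : Y) : ℝ := ∑ x, p y x

/-- Marginal of `W` when `W` is generated from `X` through the channel `q`. -/
def margW {Y X W : Type} [Fintype Y] [Fintype X] [Fintype W]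
    (p : Y → X → ℝ) (q : X → W → ℝ) (w : W) : ℝ := ∑ x, margX p x * q x w

/-- Joint pmf of `(Y, W)` under the Markov chain `Y - X - W`. -/
def jointYW {Y X W : Type} [Fintype Y] [Fintype X] [Fintype W]
    (p : Y → X → ℝ) (q : X → W → ℝ) (y : Y) (w : W) : ℝ := ∑ x, p y x * q x w

/-- Joint pmf of `(X, W)`. -/
def jointXW {Y X W : Type} [Fintype Y] [Fintype X] [Fintype W]
    (p : Y → X → ℝ) (q : X → W → ℝ) (x : X) (w : W) : ℝ := margX p x * q x w

/-- Mutual information (base 2) of a joint pmf on `A × B`. -/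
def mi2 {A B : Type} [Fintype A] [Fintype B] (r : A → B → ℝ) : ℝ :=
  shEnt (fun a => ∑ b, r a b) + shEnt (fun b => ∑ a, r a b)
    - shEnt (fun ab : A × B => r ab.1 ab.2)

/-- `I(Y;W)` under the Markov chain `Y - X - W`. -/
def miYW {Y X W : Type} [Fintype Y] [Fintype X] [Fintype W]
    (p : Y → X → ℝ) (q : X → W → ℝ) : ℝ := mi2 (jointYW p q)

/-- `I(Y;X)`. -/
def miYX {Y X : Type} [Fintype Y] [Fintype X] (p : Y → X → ℝ) : ℝ := mi2 p

/-- `I(X;W)`. -/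
def miXW {Y X W : Type} [Fintype Y] [Fintype X] [Fintype W]
    (p : Y → X → ℝ) (q : X → W → ℝ) : ℝ := mi2 (jointXW p q)

/-- The bottleneck function `F_{α,M}(γ)`: maximal relevance `I(Y;W)` over channels
`P_{W|X}` with output alphabet of size (at most) `M` satisfying `H_α(W) ≤ γ`. -/
def Ffun {Y X : Type} [Fintype Y] [Fintype X] (p : Y → X → ℝ) (M : ℕ) (α γ : ℝ) : ℝ :=
  sSup {v | ∃ q : X → Fin M → ℝ, IsKernel q ∧ entOrd α (margW p q) ≤ γ ∧ v = miYW p q}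

/-- Upper concave envelope on `[0,∞)` via two-point convex combinations. -/
def env (F : ℝ → ℝ) (γ : ℝ) : ℝ :=
  sSup {v | ∃ t γ₁ γ₂ : ℝ, 0 ≤ t ∧ t ≤ 1 ∧ 0 ≤ γ₁ ∧ 0 ≤ γ₂ ∧
    t * γ₁ + (1 - t) * γ₂ = γ ∧ v = t * F γ₁ + (1 - t) * F γ₂}

/-- The information bottleneck function `\bar I_IB(r)`. -/
def IBfun {Y X : Type} [Fintype Y] [Fintype X] (p : Y → X → ℝ) (r : ℝ) : ℝ :=
  sSup {v | ∃ (m : ℕ) (q : X → Fin m → ℝ), IsKernel q ∧ miXW p q ≤ r ∧ v = miYW p q}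

/-- The i.i.d. joint pmf of `(Yⁿ, Xⁿ)`. -/
def iidP {Y X : Type} [Fintype Y] [Fintype X] (p : Y → X → ℝ) (n : ℕ)
    (yn : Fin n → Y) (xn : Fin n → X) : ℝ := ∏ i, p (yn i) (xn i)

open Classical in
/-- Joint pmf of `(Y_i, W_i)` when `Wⁿ` is produced from `Xⁿ` by the (possibly randomized)
code `Q` and `(Yⁿ, Xⁿ)` is i.i.d. with per-letter law `p`. -/
def pairYW {Y X W : Type} [Fintype Y] [Fintype X] [Fintype W]
    (p : Y → X → ℝ) (n : ℕ) (Q : (Fin n → X) → (Fin n → W) → ℝ) (i : Fin n)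
    (y : Y) (w : W) : ℝ :=
  ∑ yn : Fin n → Y, ∑ xn : Fin n → X, ∑ wn : Fin n → W,
    iidP p n yn xn * Q xn wn * (if yn i = y ∧ wn i = w then 1 else 0)

/-- Average per-letter output Rényi entropy `γ_n = (1/n) ∑ H_α(W_i)` of a code. -/
def avgRenyi {Y X W : Type} [Fintype Y] [Fintype X] [Fintype W]
    (p : Y → X → ℝ) (n : ℕ) (Q : (Fin n → X) → (Fin n → W) → ℝ) (α : ℝ) : ℝ :=
  (1 / (n : ℝ)) * ∑ i : Fin n, renyiEnt α (fun w => ∑ y, pairYW p n Q i y w)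

/-- Average per-letter relevance `η_n = (1/n) ∑ I(Y_i; W_i)` of a code. -/
def avgRel {Y X W : Type} [Fintype Y] [Fintype X] [Fintype W]
    (p : Y → X → ℝ) (n : ℕ) (Q : (Fin n → X) → (Fin n → W) → ℝ) : ℝ :=
  (1 / (n : ℝ)) * ∑ i : Fin n, mi2 (pairYW p n Q i)

/-- A Rényi entropy-relevance pair `(γ, η)` is achievable if some sequence of
(possibly randomized) codes `Φⁿ : 𝒳ⁿ → 𝒲ⁿ`, `|𝒲| ≤ M`, has
`limsup γ_n ≤ γ` and `liminf η_n ≥ η`. -/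
def Achievable {Y X : Type} [Fintype Y] [Fintype X]
    (p : Y → X → ℝ) (M : ℕ) (α γ η : ℝ) : Prop :=
  ∃ Q : (n : ℕ) → (Fin n → X) → (Fin n → Fin M) → ℝ,
    (∀ n, IsKernel (Q n)) ∧
    Filter.limsup (fun n => avgRenyi p n (Q n) α) Filter.atTop ≤ γ ∧
    η ≤ Filter.liminf (fun n => avgRel p n (Q n)) Filter.atTop

/-- The achievable Rényi entropy-relevance region: the closure of all achievable pairs. -/
def Region {Y X : Type} [Fintype Y] [Fintype X]
    (p : Y → X → ℝ) (M : ℕ) (α : ℝ) : Set (ℝ × ℝ) :=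
  closure {z : ℝ × ℝ | 0 ≤ z.1 ∧ 0 ≤ z.2 ∧ Achievable p M α z.1 z.2}

/-- `I_{α,M}(γ)`: the maximal achievable relevance at Rényi entropy cost `γ`. -/
def Irel {Y X : Type} [Fintype Y] [Fintype X]
    (p : Y → X → ℝ) (M : ℕ) (α γ : ℝ) : ℝ :=
  sSup {η | (γ, η) ∈ Region p M α}

/-- The set of channels from `X` to `W`. -/
def channels (X W : Type) [Fintype X] [Fintype W] : Set (X → W → ℝ) := {q | IsKernel q}

/-- Deterministic channels, as functions `X → W`. -/
def detChannel {X W : Type} (f : X → W) : X → W → ℝ :=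
  open Classical in fun x => Pi.single (f x) 1

lemma channels_eq_convexHull (X W : Type) [Fintype X] [Fintype W] :
    channels X W = convexHull ℝ (Set.range (detChannel : (X → W) → X → W → ℝ)) := by
  classical
  have h : Set.range (detChannel : (X → W) → X → W → ℝ) =
      Set.univ.pi fun _ : X => Set.range fun w : W => (Pi.single w 1 : W → ℝ) := by
    ext q
    simp only [Set.mem_range, Set.mem_pi, Set.mem_univ, true_implies]
    constructor
    · rintro ⟨f, rfl⟩ x
      exact ⟨f x, by simp [detChannel]⟩
    · intro hq
      choose f hf using hq
      exact ⟨f, funext fun x => by rw [← hf x]; simp [detChannel]⟩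
  rw [h, convexHull_pi]
  ext q
  simp only [convexHull_rangle_single_eq_stdSimplex, Set.mem_pi, Set.mem_univ, true_implies,
    stdSimplex, Set.mem_ofPred_eq, channels, IsKernel]
  exact forall_and.symm

lemma convex_channels (X W : Type) [Fintype X] [Fintype W] : Convex ℝ (channels X W) := by
  rw [channels_eq_convexHull]
  exact convex_convexHull ℝ _

/-- The affine minorants of the relative entropy integrand `a log (a / b)`. -/
lemma mul_log_add_sub_le {a b c : ℝ} (ha : 0 ≤ a) (hab : a ≤ b) (hc : 0 < c) :
    a * log c + a - b * c ≤ a * (log a - log b) := by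
  rcases ha.eq_or_lt with rfl | ha
  · simpa using mul_nonneg hab hc.le
  have hb : 0 < b := ha.trans_le hab
  have h := mul_le_mul_of_nonneg_left
    (log_le_sub_one_of_pos (div_pos (mul_pos hb hc) ha)) ha.le
  rw [log_div (mul_pos hb hc).ne' ha.ne', log_mul hb.ne' hc.ne', mul_sub a (_ / _),
    mul_div_cancel₀ _ ha.ne'] at h
  linarith

lemma convexOn_relEntropy :
    ConvexOn ℝ {z : ℝ × ℝ | 0 ≤ z.1 ∧ z.1 ≤ z.2} fun z => z.1 * (log z.1 - log z.2) := by
  refine ⟨?_, ?_⟩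
  · rintro ⟨a, b⟩ ⟨ha, hab⟩ ⟨c, d⟩ ⟨hc, hcd⟩ s t hs ht _
    simp only [Set.mem_ofPred_eq, Prod.fst_add, Prod.snd_add, Prod.smul_mk, smul_eq_mul] at *
    exact ⟨by positivity, by gcongr⟩
  · rintro ⟨a, b⟩ ⟨ha, hab⟩ ⟨c, d⟩ ⟨hc, hcd⟩ s t hs ht _
    simp only [Prod.fst_add, Prod.snd_add, Prod.smul_mk, smul_eq_mul] at *
    have hA : 0 ≤ s * a + t * c := by positivity
    have hAB : s * a + t * c ≤ s * b + t * d := by gcongr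
    rcases hA.eq_or_lt with hA | hA
    · have h₁ : s * a = 0 := by nlinarith [mul_nonneg hs ha, mul_nonneg ht hc]
      have h₂ : t * c = 0 := by nlinarith [mul_nonneg hs ha, mul_nonneg ht hc]
      simp [← mul_assoc, h₁, h₂]
    · have hB := hA.trans_le hAB
      have hc' := div_pos hA hB
      have h₁ := mul_le_mul_of_nonneg_left (mul_log_add_sub_le ha hab hc') hs
      have h₂ := mul_le_mul_of_nonneg_left (mul_log_add_sub_le hc hcd hc') ht
      have h₃ := mul_div_cancel₀ (s * a + t * c) hB.ne'
      rw [← log_div hA.ne' hB.ne']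
      linear_combination h₁ + h₂ + h₃

lemma margX_nonneg {Y X : Type} [Fintype Y] [Fintype X] {p : Y → X → ℝ} (hp : IsJointPmf p)
    (x : X) : 0 ≤ margX p x :=
  Finset.sum_nonneg fun y _ => hp.1 y x

lemma margW_eq_sum_jointYW {Y X W : Type} [Fintype Y] [Fintype X] [Fintype W]
    (p : Y → X → ℝ) (q : X → W → ℝ) (w : W) : margW p q w = ∑ y, jointYW p q y w := by
  simp only [margW, margX, jointYW, Finset.sum_mul]
  exact Finset.sum_comm

lemma sum_jointYW {Y X W : Type} [Fintype Y] [Fintype X] [Fintype W]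
    (p : Y → X → ℝ) {q : X → W → ℝ} (hq : IsKernel q) (y : Y) :
    ∑ w, jointYW p q y w = margY p y := by
  simp only [jointYW, margY]
  rw [Finset.sum_comm]
  simp [← Finset.mul_sum, hq.2]

lemma jointYW_nonneg {Y X W : Type} [Fintype Y] [Fintype X] [Fintype W]
    {p : Y → X → ℝ} (hp : IsJointPmf p) {q : X → W → ℝ} (hq : IsKernel q) (y : Y) (w : W) :
    0 ≤ jointYW p q y w :=
  Finset.sum_nonneg fun x _ => mul_nonneg (hp.1 y x) (hq.1 x w)

lemma jointYW_le_margW {Y X W : Type} [Fintype Y] [Fintype X] [Fintype W]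
    {p : Y → X → ℝ} (hp : IsJointPmf p) {q : X → W → ℝ} (hq : IsKernel q) (y : Y) (w : W) :
    jointYW p q y w ≤ margW p q w := by
  rw [margW_eq_sum_jointYW]
  exact Finset.single_le_sum (f := fun y => jointYW p q y w)
    (fun y _ => jointYW_nonneg hp hq y w) (Finset.mem_univ y)

/-- `I(Y;W)` as `H(Y)` plus a sum of relative entropy integrands. -/
lemma miYW_eq {Y X W : Type} [Fintype Y] [Fintype X] [Fintype W]
    (p : Y → X → ℝ) {q : X → W → ℝ} (hq : IsKernel q) :
    miYW p q = shEnt (margY p) + (log 2)⁻¹ * ∑ y, ∑ w,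
      jointYW p q y w * (log (jointYW p q y w) - log (margW p q w)) := by
  have h : ∑ y, ∑ w, jointYW p q y w * log (margW p q w) =
      ∑ w, margW p q w * log (margW p q w) := by
    rw [Finset.sum_comm]
    simp only [← Finset.sum_mul, ← margW_eq_sum_jointYW]
  simp only [miYW, mi2, sum_jointYW p hq, ← margW_eq_sum_jointYW, mul_sub,
    Finset.sum_sub_distrib, h]
  simp only [shEnt, Fintype.sum_prod_type, logb, Finset.mul_sum, div_eq_inv_mul,
    mul_left_comm _ (log 2)⁻¹]
  ring

lemma neg_shEnt_eq {I : Type} [Fintype I] (P : I → ℝ) :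
    -shEnt P = (log 2)⁻¹ * ∑ i, P i * log (P i) := by
  simp only [shEnt, logb, Finset.mul_sum, div_eq_inv_mul, mul_left_comm _ (log 2)⁻¹, neg_neg]

lemma convexOn_sum {E ι : Type} [AddCommGroup E] [Module ℝ E] {s : Set E} (hs : Convex ℝ s)
    (t : Finset ι) {f : ι → E → ℝ} (h : ∀ i ∈ t, ConvexOn ℝ s (f i)) :
    ConvexOn ℝ s fun x => ∑ i ∈ t, f i x := by
  classical
  induction t using Finset.induction_on with
  | empty => simpa using convexOn_const 0 hs
  | insert i t hi ih =>
    simp only [Finset.sum_insert hi]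
    exact (h i (by simp)).add (ih fun j hj => h j (by simp [hj]))

/-- `∑ x, c x * q x w` as a linear functional of the channel `q`. -/
def outputMap {X W : Type} [Fintype X] (c : X → ℝ) (w : W) : (X → W → ℝ) →ₗ[ℝ] ℝ :=
  ∑ x, c x • ((LinearMap.proj w : (W → ℝ) →ₗ[ℝ] ℝ) ∘ₗ LinearMap.proj x)

lemma outputMap_apply {X W : Type} [Fintype X] (c : X → ℝ) (w : W) (q : X → W → ℝ) :
    outputMap c w q = ∑ x, c x * q x w := by
  simp [outputMap]

lemma convexOn_miYW {Y X W : Type} [Fintype Y] [Fintype X] [Fintype W]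
    {p : Y → X → ℝ} (hp : IsJointPmf p) : ConvexOn ℝ (channels X W) (miYW p) := by
  have hC := convex_channels X W
  have hlog : 0 ≤ (log 2)⁻¹ := inv_nonneg.2 (log_nonneg one_le_two)
  refine ((convexOn_const (shEnt (margY p)) hC).add ((convexOn_sum hC Finset.univ fun y _ =>
    convexOn_sum hC Finset.univ fun w _ => ?_).smul hlog)).congr fun q hq => (miYW_eq p hq).symm
  have h := convexOn_relEntropy.comp_linearMap
    ((outputMap (p y) w).prod (outputMap (margX p) w))
  simp only [Function.comp_def, LinearMap.prod_apply, Function.prod, outputMap_apply] at h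
  refine h.subset (fun q hq => ?_) hC
  simp only [Set.mem_preimage, LinearMap.prod_apply, Function.prod, outputMap_apply, Set.mem_ofPred_eq]
  exact ⟨jointYW_nonneg hp hq y w, jointYW_le_margW hp hq y w⟩

lemma convexOn_neg_shEnt_margW {Y X W : Type} [Fintype Y] [Fintype X] [Fintype W]
    {p : Y → X → ℝ} (hp : IsJointPmf p) :
    ConvexOn ℝ (channels X W) fun q => -shEnt (margW p q) := by
  have hC := convex_channels X W
  have hlog : 0 ≤ (log 2)⁻¹ := inv_nonneg.2 (log_nonneg one_le_two)
  simp only [neg_shEnt_eq]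
  refine (convexOn_sum hC Finset.univ fun w _ => ?_).smul hlog
  have h := convexOn_mul_log.comp_linearMap (outputMap (margX p) w)
  simp only [Function.comp_def, outputMap_apply] at h
  refine h.subset (fun q hq => ?_) hC
  simp only [Set.mem_preimage, outputMap_apply, Set.mem_Ici]
  exact Finset.sum_nonneg fun x _ => mul_nonneg (margX_nonneg hp x) (hq.1 x w)

/-- for every `β ≥ 0`, the maximum of `β I(Y;W) − H(W)` over channels
`P_{W|X}` is attained by a deterministic channel. -/
theorem stmt8 {Y X W : Type} [Fintype Y] [Fintype X] [Fintype W] [Nonempty W]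
    (p : Y → X → ℝ) (hp : IsJointPmf p) (β : ℝ) (hβ : 0 ≤ β) :
    ∃ q : X → W → ℝ, IsKernel q ∧ (∀ x w, q x w = 0 ∨ q x w = 1) ∧
      ∀ q' : X → W → ℝ, IsKernel q' →
        β * miYW p q' - shEnt (margW p q') ≤ β * miYW p q - shEnt (margW p q) := by
  classical
  have hconv : ConvexOn ℝ (channels X W) fun q => β * miYW p q - shEnt (margW p q) :=
    (((convexOn_miYW hp).smul hβ).add (convexOn_neg_shEnt_margW hp)).congr
      fun q _ => (sub_eq_add_neg _ _).symm
  have hsub : Set.range (detChannel : (X → W) → X → W → ℝ) ⊆ channels X W :=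
    channels_eq_convexHull X W ▸ subset_convexHull ℝ _
  obtain ⟨f, hf⟩ := Finite.exists_max fun f : X → W =>
    β * miYW p (detChannel f) - shEnt (margW p (detChannel f))
  refine ⟨detChannel f, hsub ⟨f, rfl⟩, fun x w => ?_, fun q' hq' => ?_⟩
  · by_cases h : w = f x <;> simp [detChannel, h]
  · have hmem : q' ∈ convexHull ℝ (Set.range (detChannel : (X → W) → X → W → ℝ)) :=
      channels_eq_convexHull X W ▸ hq'
    obtain ⟨_, ⟨g, rfl⟩, hg⟩ := hconv.exists_ge_of_mem_convexHull hsub hmem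
    exact hg.trans (hf g)

end
end

section
/- (Example 2) Suppose the joint probability matrix P_{Y,X} has a block-diagonal structure with K blocks: there are partitions 𝒳 = 𝒳₁ ∪ … ∪ 𝒳_K and 𝒴 = 𝒴₁ ∪ … ∪ 𝒴_K such that P_{Y,X}(y,x) = p_k > 0 for all (y,x) ∈ 𝒴_k × 𝒳_k and P_{Y,X}(y,x) = 0 whenever x and y lie in different blocks. Let s_k = |𝒳_k||𝒴_k| p_k. Then for any finite M ≥ K, \bar I_{1,M}(γ) = Ω(γ) for all γ ≥ 0, where Ω(γ) = min(γ, I(Y;X)). -/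
open Real BigOperators Filter

noncomputable section

lemma shEnt_prod {A B : Type} [Fintype A] [Fintype B] (r : A → B → ℝ) :
    shEnt (fun ab : A × B => r ab.1 ab.2) = ∑ b, shEnt (fun a => r a b) := by
  simp only [shEnt, Finset.sum_neg_distrib, Fintype.sum_prod_type_right]

/-- A marginal has at most the entropy of the joint vector. -/
lemma shEnt_marginal_le {A B : Type} [Fintype A] [Fintype B] (r : A → B → ℝ)
    (hr : ∀ a b, 0 ≤ r a b) :
    shEnt (fun b => ∑ a, r a b) ≤ shEnt (fun ab : A × B => r ab.1 ab.2) := by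
  rw [shEnt_prod, shEnt, ← Finset.sum_neg_distrib]
  refine Finset.sum_le_sum fun b _ => ?_
  rw [shEnt, neg_le_neg_iff, Finset.sum_mul]
  refine Finset.sum_le_sum fun a _ => ?_
  rcases (hr a b).eq_or_lt with h | h
  · simp [← h]
  · exact mul_le_mul_of_nonneg_left (Real.logb_le_logb_of_le one_lt_two h
      (Finset.single_le_sum (f := fun a => r a b) (fun a _ => hr a b) (Finset.mem_univ a))) h.le

lemma shEnt_swap {A B : Type} [Fintype A] [Fintype B] (r : A → B → ℝ) :
    shEnt (fun ba : B × A => r ba.2 ba.1) = shEnt (fun ab : A × B => r ab.1 ab.2) := by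
  simp only [shEnt]
  rw [Fintype.sum_prod_type_right, Fintype.sum_prod_type]

/-- If the first coordinate is a function of the second, the joint entropy is the entropy of the
second marginal. -/
lemma shEnt_eq_marginal {A B : Type} [Fintype A] [Fintype B] (r : A → B → ℝ) (g : B → A)
    (hr : ∀ a b, a ≠ g b → r a b = 0) :
    shEnt (fun ab : A × B => r ab.1 ab.2) = shEnt (fun b => ∑ a, r a b) := by
  rw [shEnt_prod, shEnt, ← Finset.sum_neg_distrib]
  refine Finset.sum_congr rfl fun b _ => ?_
  rw [shEnt, Fintype.sum_eq_single (g b) fun a ha => by simp [hr a b ha],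
    Fintype.sum_eq_single (g b) fun a ha => hr a b ha]

lemma mi2_le_right {A B : Type} [Fintype A] [Fintype B] (r : A → B → ℝ)
    (hr : ∀ a b, 0 ≤ r a b) : mi2 r ≤ shEnt (fun b => ∑ a, r a b) := by
  have h := shEnt_marginal_le (fun b a => r a b) fun b a => hr a b
  rw [shEnt_swap r] at h
  rw [mi2]
  linarith

lemma mi2_le_left {A B : Type} [Fintype A] [Fintype B] (r : A → B → ℝ)
    (hr : ∀ a b, 0 ≤ r a b) : mi2 r ≤ shEnt (fun a => ∑ b, r a b) := by
  have h := shEnt_marginal_le r hr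
  rw [mi2]
  linarith

lemma mi2_eq_left {A B : Type} [Fintype A] [Fintype B] (r : A → B → ℝ) (g : B → A)
    (hr : ∀ a b, a ≠ g b → r a b = 0) : mi2 r = shEnt (fun a => ∑ b, r a b) := by
  rw [mi2, shEnt_eq_marginal r g hr]
  ring

lemma mi2_eq_right {A B : Type} [Fintype A] [Fintype B] (r : A → B → ℝ) (g : A → B)
    (hr : ∀ a b, b ≠ g a → r a b = 0) : mi2 r = shEnt (fun b => ∑ a, r a b) := by
  rw [mi2, ← shEnt_swap r, shEnt_eq_marginal (fun b a => r a b) g fun b a => hr a b]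
  ring

/-- The number of preimages of a point, as a real number. -/
def fiberCard {I J : Type} [Fintype I] [DecidableEq J] (f : I → J) (j : J) : ℝ :=
  ((Finset.univ.filter fun i => f i = j).card : ℝ)

lemma fiberCard_pos {I J : Type} [Fintype I] [DecidableEq J] {f : I → J}
    (hf : Function.Surjective f) (j : J) : 0 < fiberCard f j := by
  obtain ⟨i, hi⟩ := hf j
  exact Nat.cast_pos.mpr (Finset.card_pos.mpr ⟨i, by simp [hi]⟩)

lemma sum_comp_eq_sum_fiberCard_mul {I J : Type} [Fintype I] [Fintype J] [DecidableEq J]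
    (f : I → J) (g : J → ℝ) : ∑ i, g (f i) = ∑ j, fiberCard f j * g j := by
  rw [← Finset.sum_fiberwise' Finset.univ f g]
  simp [fiberCard]

lemma shEnt_comp {I J : Type} [Fintype I] [Fintype J] [DecidableEq J] {f : I → J}
    (hf : Function.Surjective f) (P : J → ℝ) :
    shEnt (fun i => P (f i)) = shEnt (fun j => fiberCard f j * P j)
      + ∑ j, fiberCard f j * P j * Real.logb 2 (fiberCard f j) := by
  rw [shEnt, shEnt, sum_comp_eq_sum_fiberCard_mul f fun j => P j * Real.logb 2 (P j),
    ← Finset.sum_neg_distrib, ← Finset.sum_neg_distrib, ← Finset.sum_add_distrib]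
  refine Finset.sum_congr rfl fun j _ => ?_
  by_cases h : P j = 0
  · simp [h]
  · rw [Real.logb_mul (fiberCard_pos hf j).ne' h]
    ring

/-- Merging the letters that share the same row does not change the mutual information. -/
lemma mi2_comp {I J W : Type} [Fintype I] [Fintype J] [DecidableEq J] [Fintype W] {f : I → J}
    (hf : Function.Surjective f) (d : J → W → ℝ) :
    mi2 (fun i w => d (f i) w) = mi2 (fun j w => fiberCard f j * d j w) := by
  have h₁ := shEnt_comp hf fun j => ∑ w, d j w
  have h₂ : ∀ w, shEnt (fun i => d (f i) w) = _ := fun w => shEnt_comp hf fun j => d j w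
  rw [mi2, mi2, h₁, shEnt_prod fun i w => d (f i) w,
    shEnt_prod fun j w => fiberCard f j * d j w]
  simp only [h₂, Finset.sum_add_distrib, Finset.mul_sum, Finset.sum_mul,
    fun w => sum_comp_eq_sum_fiberCard_mul f fun j => d j w]
  rw [Finset.sum_comm (f := fun w j => fiberCard f j * d j w * Real.logb 2 (fiberCard f j))]
  ring

lemma Ffun_le {Y X : Type} [Fintype Y] [Fintype X] {p : Y → X → ℝ} {M : ℕ} {γ b : ℝ}
    (hb : 0 ≤ b) (h : ∀ q : X → Fin M → ℝ, IsKernel q → entOrd 1 (margW p q) ≤ γ →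
      miYW p q ≤ b) : Ffun p M 1 γ ≤ b := by
  refine Real.sSup_le ?_ hb
  rintro v ⟨q, hq, hγ, rfl⟩
  exact h q hq hγ

lemma le_Ffun {Y X : Type} [Fintype Y] [Fintype X] {p : Y → X → ℝ} {M : ℕ} {γ b : ℝ}
    (h : ∀ q : X → Fin M → ℝ, IsKernel q → miYW p q ≤ b) {q : X → Fin M → ℝ}
    (hq : IsKernel q) (hγ : entOrd 1 (margW p q) ≤ γ) : miYW p q ≤ Ffun p M 1 γ := by
  refine le_csSup ⟨b, ?_⟩ ⟨q, hq, hγ, rfl⟩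
  rintro v ⟨q, hq, -, rfl⟩
  exact h q hq

/-- If `F` lies below `min γ h` and touches it at `0` and on `[h, ∞)`, then the concave envelope
of `F` is `min γ h`. -/
lemma env_eq_min {F : ℝ → ℝ} {h γ : ℝ} (hh : 0 ≤ h) (hγ : 0 ≤ γ)
    (hle : ∀ γ, 0 ≤ γ → F γ ≤ min γ h) (hF0 : 0 ≤ F 0) (hFh : ∀ γ, h ≤ γ → h ≤ F γ) :
    env F γ = min γ h := by
  have ub : min γ h ∈ upperBounds {v | ∃ t γ₁ γ₂ : ℝ, 0 ≤ t ∧ t ≤ 1 ∧ 0 ≤ γ₁ ∧ 0 ≤ γ₂ ∧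
      t * γ₁ + (1 - t) * γ₂ = γ ∧ v = t * F γ₁ + (1 - t) * F γ₂} := by
    rintro v ⟨t, a, b, ht0, ht1, ha, hb, hab, rfl⟩
    have h₁ := le_min_iff.mp (hle a ha)
    have h₂ := le_min_iff.mp (hle b hb)
    have ht2 : 0 ≤ 1 - t := sub_nonneg.mpr ht1
    refine le_min ?_ ?_
    · rw [← hab]
      exact add_le_add (mul_le_mul_of_nonneg_left h₁.1 ht0) (mul_le_mul_of_nonneg_left h₂.1 ht2)
    · linarith [mul_le_mul_of_nonneg_left h₁.2 ht0, mul_le_mul_of_nonneg_left h₂.2 ht2]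
  refine le_antisymm (csSup_le ⟨_, 1, γ, 0, by norm_num, le_rfl, hγ, le_rfl, by ring, rfl⟩ ub) ?_
  rcases le_or_gt h γ with hc | hc
  · rw [min_eq_right hc]
    refine le_csSup_of_le ⟨_, ub⟩ ⟨1, γ, 0, by norm_num, le_rfl, hγ, le_rfl, by ring, rfl⟩ ?_
    simpa using hFh γ hc
  · have hpos : 0 < h := hγ.trans_lt hc
    have hdiv : γ / h ≤ 1 := (div_le_one hpos).mpr hc.le
    have hmul : γ / h * h = γ := div_mul_cancel₀ γ hpos.ne'
    rw [min_eq_left hc.le]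
    refine le_csSup_of_le ⟨_, ub⟩ ⟨γ / h, h, 0, div_nonneg hγ hh, hdiv, hh, le_rfl,
      by rw [hmul]; ring, rfl⟩ ?_
    have h₁ := mul_le_mul_of_nonneg_left (hFh h le_rfl) (div_nonneg hγ hh)
    have h₂ := mul_nonneg (sub_nonneg.mpr hdiv) hF0
    linarith

/-- The joint vector of block and `W` in a block-diagonal model, where `c k` is the marginal mass
of each letter `x` of block `k`. -/
def blockJoint {X W : Type} [Fintype X] {K : ℕ} (bX : X → Fin K) (c : Fin K → ℝ)
    (q : X → W → ℝ) (k : Fin K) (w : W) : ℝ :=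
  ∑ x, if k = bX x then c k * q x w else 0

lemma blockJoint_nonneg {X W : Type} [Fintype X] [Fintype W] {K : ℕ} {bX : X → Fin K}
    {c : Fin K → ℝ} (hc : ∀ k, 0 ≤ c k) {q : X → W → ℝ} (hq : IsKernel q) (k : Fin K) (w : W) :
    0 ≤ blockJoint bX c q k w :=
  Finset.sum_nonneg fun x _ => by
    split_ifs
    exacts [mul_nonneg (hc k) (hq.1 x w), le_rfl]

lemma sum_blockJoint {X W : Type} [Fintype X] [Fintype W] {K : ℕ} (bX : X → Fin K)
    (c : Fin K → ℝ) {q : X → W → ℝ} (hq : IsKernel q) (k : Fin K) :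
    ∑ w, blockJoint bX c q k w = ∑ x, if k = bX x then c k else 0 := by
  simp only [blockJoint]
  rw [Finset.sum_comm]
  refine Finset.sum_congr rfl fun x _ => ?_
  split_ifs
  · rw [← Finset.mul_sum, hq.2, mul_one]
  · simp

lemma blockJoint_deterministic_eq_zero {X W : Type} [Fintype X] [DecidableEq W] {K : ℕ}
    {bX : X → Fin K} (c : Fin K → ℝ) {g : X → W} {k : Fin K} {w : W}
    (h : ∀ x, k = bX x → w ≠ g x) :
    blockJoint bX c (fun x w => if w = g x then 1 else 0) k w = 0 :=
  Finset.sum_eq_zero fun x _ => by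
    by_cases hk : k = bX x
    · simp [hk, h x hk]
    · exact if_neg hk

section BlockDiagonal

variable {Y X W : Type} [Fintype Y] [Fintype X] [Fintype W] {K : ℕ} {bX : X → Fin K}
  {bY : Y → Fin K} {pk : Fin K → ℝ} {p : Y → X → ℝ}

lemma jointYW_blockDiagonal (hpdef : ∀ y x, p y x = if bY y = bX x then pk (bX x) else 0)
    (q : X → W → ℝ) :
    jointYW p q = fun y w => blockJoint bX pk q (bY y) w := by
  funext y w
  refine Finset.sum_congr rfl fun x _ => ?_
  rw [hpdef]
  split_ifs with h <;> simp [h]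

lemma miYW_blockDiagonal (hbY : Function.Surjective bY)
    (hpdef : ∀ y x, p y x = if bY y = bX x then pk (bX x) else 0) (q : X → W → ℝ) :
    miYW p q = mi2 (blockJoint bX (fun k => fiberCard bY k * pk k) q) := by
  rw [miYW, jointYW_blockDiagonal hpdef, mi2_comp hbY]
  congr 1
  funext k w
  simp only [blockJoint, Finset.mul_sum, mul_ite, mul_zero, mul_assoc]

lemma margW_blockDiagonal (hpdef : ∀ y x, p y x = if bY y = bX x then pk (bX x) else 0)
    (q : X → W → ℝ) :
    margW p q = fun w => ∑ k, blockJoint bX (fun k => fiberCard bY k * pk k) q k w := by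
  funext w
  have h : margW p q w = ∑ y, jointYW p q y w := by
    simp only [margW, margX, jointYW, Finset.sum_mul]
    exact Finset.sum_comm
  rw [h, jointYW_blockDiagonal hpdef,
    sum_comp_eq_sum_fiberCard_mul bY fun k => blockJoint bX pk q k w]
  refine Finset.sum_congr rfl fun k _ => ?_
  simp only [blockJoint, Finset.mul_sum, mul_ite, mul_zero, mul_assoc]

end BlockDiagonal

lemma isKernel_deterministic {X W : Type} [Fintype X] [Fintype W] [DecidableEq W] (g : X → W) :
    IsKernel (fun x w => if w = g x then (1 : ℝ) else 0) :=
  ⟨fun x w => ite_nonneg zero_le_one le_rfl, fun x => by simp⟩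

lemma entOrd_one {I : Type} [Fintype I] (P : I → ℝ) : entOrd 1 P = shEnt P := if_pos rfl

/-- Example 2: if `P_{Y,X}` is block diagonal with `K` blocks, each block
`𝒴_k × 𝒳_k` carrying identical mass `p_k > 0` on its entries, then for any finite
`M ≥ K` and all `γ ≥ 0`, `\bar I_{1,M}(γ) = Ω(γ) = min(γ, I(Y;X))`. -/
theorem stmt16 {Y X : Type} [Fintype Y] [Fintype X]
    (K : ℕ) (hK : 0 < K)
    (bX : X → Fin K) (hbX : Function.Surjective bX)
    (bY : Y → Fin K) (hbY : Function.Surjective bY)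
    (pk : Fin K → ℝ) (hpk : ∀ k, 0 < pk k)
    (p : Y → X → ℝ) (hpdef : ∀ y x, p y x = if bY y = bX x then pk (bX x) else 0)
    (hp : IsJointPmf p)
    (M : ℕ) (hM : K ≤ M) (γ : ℝ) (hγ : 0 ≤ γ) :
    env (Ffun p M 1) γ = min γ (miYX p) := by
  classical
  set c : Fin K → ℝ := fun k => fiberCard bY k * pk k
  have hc0 : ∀ k, 0 ≤ c k := fun k => (mul_pos (fiberCard_pos hbY k) (hpk k)).le
  set h : ℝ := shEnt (fun k => ∑ x, if k = bX x then c k else 0) with hh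
  have hmi : ∀ {W : Type} [Fintype W] (q : X → W → ℝ), miYW p q = mi2 (blockJoint bX c q) :=
    fun q => miYW_blockDiagonal hbY hpdef q
  have hW : ∀ {W : Type} [Fintype W] (q : X → W → ℝ),
      entOrd 1 (margW p q) = shEnt fun w => ∑ k, blockJoint bX c q k w :=
    fun q => by rw [entOrd_one, margW_blockDiagonal hpdef q]
  have hB : ∀ {W : Type} [Fintype W] {q : X → W → ℝ}, IsKernel q →
      shEnt (fun k => ∑ w, blockJoint bX c q k w) = h := fun hq => by
    simp only [sum_blockJoint bX c hq, hh]
  have hle_h : ∀ q : X → Fin M → ℝ, IsKernel q → miYW p q ≤ h := fun q hq => by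
    rw [hmi, ← hB hq]
    exact mi2_le_left _ (blockJoint_nonneg hc0 hq)
  have hle_W : ∀ q : X → Fin M → ℝ, IsKernel q → miYW p q ≤ entOrd 1 (margW p q) :=
    fun q hq => by
      rw [hmi, hW]
      exact mi2_le_right _ (blockJoint_nonneg hc0 hq)
  -- the identity channel reproduces `p`
  have hYX : miYX p = h := by
    have hid := isKernel_deterministic (id : X → X)
    rw [← hB hid, ← mi2_eq_left (blockJoint bX c _) bX, ← hmi, miYX, miYW]
    · congr 1
      funext y x
      simp [jointYW]
    · exact fun k x hk => blockJoint_deterministic_eq_zero c fun z hz hxz =>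
        hk (by rw [hz, hxz, id])
  -- the channel revealing the block
  have hblock := isKernel_deterministic fun x => Fin.castLE hM (bX x)
  have hblock_zero : ∀ k w, w ≠ Fin.castLE hM k → blockJoint bX c
      (fun x w => if w = Fin.castLE hM (bX x) then 1 else 0) k w = 0 := fun k w hw =>
    blockJoint_deterministic_eq_zero c fun x hx => hx ▸ hw
  have hblock_mi : miYW p (fun x w => if w = Fin.castLE hM (bX x) then 1 else 0) = h := by
    rw [← hB hblock, hmi]
    refine mi2_eq_left _ (fun w => if hw : w.1 < K then ⟨w, hw⟩ else ⟨0, hK⟩) fun k w hk =>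
      hblock_zero k w ?_
    rintro rfl
    simp at hk
  have hblock_ent :
      entOrd 1 (margW p fun x w => if w = Fin.castLE hM (bX x) then 1 else 0) = h := by
    rw [hW, ← mi2_eq_right _ _ hblock_zero, ← hmi, hblock_mi]
  -- a constant channel
  set w₀ : Fin M := Fin.castLE hM ⟨0, hK⟩
  have hconst := isKernel_deterministic fun _ : X => w₀
  have hconst_ent : entOrd 1 (margW p fun _ w => if w = w₀ then 1 else 0) = 0 := by
    have hX : ∑ x, margX p x = 1 := by
      rw [← hp.2]
      exact Finset.sum_comm
    simp [entOrd_one, shEnt, margW, hX, ite_mul]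
  have hconst_mi : miYW p (fun _ w => if w = w₀ then 1 else 0) = 0 := by
    rw [hmi, mi2_eq_right _ (fun _ => w₀) fun k w hw =>
      blockJoint_deterministic_eq_zero c fun _ _ => hw, ← hW, hconst_ent]
  have hh0 : 0 ≤ h := hconst_mi ▸ hle_h _ hconst
  rw [hYX]
  refine env_eq_min hh0 hγ (fun γ hγ => ?_) ?_ fun γ hγ => ?_
  · exact Ffun_le (le_min hγ hh0) fun q hq hqγ => le_min ((hle_W q hq).trans hqγ) (hle_h q hq)
  · exact hconst_mi.ge.trans (le_Ffun hle_h hconst hconst_ent.le)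
  · exact hblock_mi.ge.trans (le_Ffun hle_h hblock (hblock_ent.trans_le hγ))

end
end
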